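/- arXiv:2002.10924 — 8 statements merged into one kernel-verified Lean document; each statement's English description precedes it below -/
import Mathlib

section
/- Let u : Θ → V be differentiable and satisfy A(u(θ), v; θ) = F(v; θ) for all v ∈ V and all θ ∈ Θ. Then for every θ ∈ Θ, the sum of the norms of the partial derivatives satisfies ∑_{j=1}^d ‖∂_{θ_j} u(θ)‖_V ≤ (C_u(θ)/α(θ)) ∑_{j=1}^d ρ_j(θ) + ∑_{j=1}^d ‖∂_{θ_j} F(·;θ)‖_{V'} / α(θ), where C_u(θ) := ‖F(·;θ)‖_{V'} / α(θ). -/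
/-- A vector `w` with `a * ‖w‖ ^ 2 ≤ c * ‖w‖`, as produced by coercivity, has norm at most `c / a`. -/
theorem norm_le_div_of_mul_sq_le {V : Type*} [NormedAddCommGroup V] {a c : ℝ} (ha : 0 < a)
    (hc : 0 ≤ c) {w : V} (h : a * ‖w‖ ^ 2 ≤ c * ‖w‖) : ‖w‖ ≤ c / a := by
  rcases (norm_nonneg w).eq_or_lt with hw | hw
  · rw [← hw]
    positivity
  · rw [le_div_iff₀ ha]
    refine le_of_mul_le_mul_right ?_ hw
    linarith [show ‖w‖ * a * ‖w‖ = a * ‖w‖ ^ 2 by ring]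

/-- The solution of a coercive variational problem is bounded by the dual norm of the data. -/
theorem norm_le_opNorm_div_of_coercive {V : Type*} [NormedAddCommGroup V] [NormedSpace ℝ V]
    {B : V →L[ℝ] V →L[ℝ] ℝ} {f : V →L[ℝ] ℝ} {a : ℝ} (ha : 0 < a)
    (hB : ∀ w, a * ‖w‖ ^ 2 ≤ B w w) {x : V} (hx : ∀ v, B x v = f v) : ‖x‖ ≤ ‖f‖ / a :=
  norm_le_div_of_mul_sq_le ha (norm_nonneg f)
    ((hB x).trans ((hx x).trans_le ((le_abs_self _).trans (f.le_opNorm x))))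

/-- Differentiating the identity `A θ (u θ) = F θ` in the direction `e`. -/
theorem fderiv_variational_eq {E V : Type*} [NormedAddCommGroup E] [NormedSpace ℝ E]
    [NormedAddCommGroup V] [NormedSpace ℝ V] {A : E → V →L[ℝ] V →L[ℝ] ℝ} {F : E → V →L[ℝ] ℝ}
    {u : E → V} {θ : E} (hA : DifferentiableAt ℝ A θ) (hu : DifferentiableAt ℝ u θ)
    (h : ∀ᶠ t in nhds θ, A t (u t) = F t) (e : E) (v : V) :
    A θ (fderiv ℝ u θ e) v + fderiv ℝ A θ e (u θ) v = fderiv ℝ F θ e v := by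
  have hd : fderiv ℝ (fun t => A t (u t)) θ = fderiv ℝ F θ := Filter.EventuallyEq.fderiv_eq h
  rw [← hd, fderiv_clm_apply hA hu]
  simp

/-- **Stability of the parameter sensitivities of the state.**
Let `θ ↦ A(·,·;θ)` be a continuously-differentiable-in-`θ` family of coercive
bilinear forms on the Hilbert space `V` over an open set `Θ ⊆ ℝ^d`, with coercivity
constants `α(θ) > 0` and derivative bounds `∂_{θ_j} A(w,v;θ) ≤ ρ_j(θ)‖w‖‖v‖`, and
`θ ↦ F(·;θ)` a differentiable family of bounded linear functionals.
If `u : Θ → V` is differentiable and satisfies `A(u(θ),v;θ) = F(v;θ)` for all `v`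
and `θ ∈ Θ`, then for every `θ ∈ Θ`,
`∑_j ‖∂_{θ_j} u(θ)‖ ≤ (C_u(θ)/α(θ)) ∑_j ρ_j(θ) + ∑_j ‖∂_{θ_j} F(·;θ)‖_{V'}/α(θ)`,
with `C_u(θ) = ‖F(·;θ)‖_{V'}/α(θ)`. -/
theorem state_sensitivity_bound
    {V : Type*} [NormedAddCommGroup V] [InnerProductSpace ℝ V] [CompleteSpace V]
    {d : ℕ} (Θ : Set (EuclideanSpace ℝ (Fin d))) (hΘ : IsOpen Θ)
    (A : EuclideanSpace ℝ (Fin d) → V →L[ℝ] V →L[ℝ] ℝ)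
    (F : EuclideanSpace ℝ (Fin d) → V →L[ℝ] ℝ)
    (α : EuclideanSpace ℝ (Fin d) → ℝ)
    (ρ : Fin d → EuclideanSpace ℝ (Fin d) → ℝ)
    (hA : ∀ θ ∈ Θ, DifferentiableAt ℝ A θ)
    (hF : ∀ θ ∈ Θ, DifferentiableAt ℝ F θ)
    (hα : ∀ θ ∈ Θ, 0 < α θ)
    (hcoer : ∀ θ ∈ Θ, ∀ w : V, α θ * ‖w‖ ^ 2 ≤ A θ w w)
    (hρ : ∀ θ ∈ Θ, ∀ j : Fin d, ∀ w v : V,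
      fderiv ℝ A θ (EuclideanSpace.single j (1 : ℝ)) w v ≤ ρ j θ * ‖w‖ * ‖v‖)
    (u : EuclideanSpace ℝ (Fin d) → V)
    (hu : ∀ θ ∈ Θ, DifferentiableAt ℝ u θ)
    (heq : ∀ θ ∈ Θ, ∀ v : V, A θ (u θ) v = F θ v) :
    ∀ θ ∈ Θ,
      ∑ j : Fin d, ‖fderiv ℝ u θ (EuclideanSpace.single j (1 : ℝ))‖ ≤
        (‖F θ‖ / α θ) / α θ * ∑ j : Fin d, ρ j θ +
          ∑ j : Fin d, ‖fderiv ℝ F θ (EuclideanSpace.single j (1 : ℝ))‖ / α θ := by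
  intro θ hθ
  have ha := hα θ hθ
  rw [Finset.mul_sum, ← Finset.sum_add_distrib]
  refine Finset.sum_le_sum fun j _ => ?_
  set e := EuclideanSpace.single j (1 : ℝ)
  rcases subsingleton_or_nontrivial V with hV | hV
  · simp [Subsingleton.elim (F θ) 0, Subsingleton.elim (fderiv ℝ u θ e) 0]
  have hρ_nonneg : 0 ≤ ρ j θ := by
    obtain ⟨w, hw⟩ := exists_ne (0 : V)
    have h₁ := hρ θ hθ j w w
    have h₂ := hρ θ hθ j (-w) w
    simp only [map_neg, neg_apply, norm_neg] at h₂
    have hpos := norm_pos_iff.mpr hw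
    refine nonneg_of_mul_nonneg_left (b := ‖w‖ * ‖w‖) ?_ (by positivity)
    linarith
  have hu_norm := norm_le_opNorm_div_of_coercive ha (hcoer θ hθ) (heq θ hθ)
  have hderiv := fderiv_variational_eq (hA θ hθ) (hu θ hθ)
    ((hΘ.eventually_mem hθ).mono fun t ht => ContinuousLinearMap.ext (heq t ht)) e
    (fderiv ℝ u θ e)
  have hA_bound := hρ θ hθ j (-u θ) (fderiv ℝ u θ e)
  simp only [map_neg, neg_apply, norm_neg] at hA_bound
  have hF_bound := (le_abs_self _).trans ((fderiv ℝ F θ e).le_opNorm (fderiv ℝ u θ e))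
  have hc := hcoer θ hθ (fderiv ℝ u θ e)
  calc ‖fderiv ℝ u θ e‖ ≤ (ρ j θ * ‖u θ‖ + ‖fderiv ℝ F θ e‖) / α θ :=
        norm_le_div_of_mul_sq_le ha (by positivity) (by linarith)
    _ ≤ (ρ j θ * (‖F θ‖ / α θ) + ‖fderiv ℝ F θ e‖) / α θ := by gcongr
    _ = ‖F θ‖ / α θ / α θ * ρ j θ + ‖fderiv ℝ F θ e‖ / α θ := by ring
end

section
/- Let V_h be a subspace of V. Suppose u_h ∈ V_h satisfies A(u_h, v) = F(v) for all v ∈ V_h, ψ_h ∈ V_h satisfies A(w, ψ_h) = (y − O(u_h))ᵀ Γ⁻¹ O(w) for all w ∈ V_h, and let u_r, ψ_r ∈ V_h be arbitrary. Define the dual-weighted residual Δ = A(u_r, ψ_r) − F(ψ_r). Then |η(u_h) − η(u_r) − Δ| ≤ γ ‖u_h − u_r‖_V ‖ψ_h − ψ_r‖_V + (1/2) C_O ‖u_h − u_r‖_V². -/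
open scoped RealInnerProductSpace

/-- The continuous linear map on Euclidean space associated with a square matrix;
its operator norm is the spectral norm of the matrix. -/
noncomputable def matCLM {s : ℕ} (M : Matrix (Fin s) (Fin s) ℝ) :
    EuclideanSpace ℝ (Fin s) →L[ℝ] EuclideanSpace ℝ (Fin s) :=
  Matrix.toEuclideanCLM (𝕜 := ℝ) M

/-- The potential `η(u) = (1/2)(y − O(u))ᵀ Γ⁻¹ (y − O(u))`. -/
noncomputable def potential {V : Type*} [NormedAddCommGroup V] [InnerProductSpace ℝ V]
    {s : ℕ} (O : V →L[ℝ] EuclideanSpace ℝ (Fin s)) (y : EuclideanSpace ℝ (Fin s))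
    (Γinv : Matrix (Fin s) (Fin s) ℝ) (u : V) : ℝ :=
  (1 / 2) * ⟪y - O u, matCLM Γinv (y - O u)⟫

/-- The bilinear form of a symmetric matrix is symmetric. -/
theorem inner_matCLM_comm {s : ℕ} {M : Matrix (Fin s) (Fin s) ℝ} (hM : M.IsSymm)
    (x z : EuclideanSpace ℝ (Fin s)) : ⟪x, matCLM M z⟫ = ⟪z, matCLM M x⟫ := by
  have hadj : ContinuousLinearMap.adjoint (matCLM M) = matCLM M := by
    rw [← ContinuousLinearMap.star_eq_adjoint, matCLM, ← map_star,
      Matrix.star_eq_conjTranspose, Matrix.conjTranspose_eq_transpose_of_trivial, hM.eq]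
  rw [← ContinuousLinearMap.adjoint_inner_left, hadj, real_inner_comm]

/-- The potential is quadratic, so its second-order Taylor expansion is exact. -/
theorem potential_sub_potential {V : Type*} [NormedAddCommGroup V] [InnerProductSpace ℝ V]
    {s : ℕ} (O : V →L[ℝ] EuclideanSpace ℝ (Fin s)) (y : EuclideanSpace ℝ (Fin s))
    {M : Matrix (Fin s) (Fin s) ℝ} (hM : M.IsSymm) (u v : V) :
    potential O y M u - potential O y M v =
      -⟪y - O u, matCLM M (O (u - v))⟫ - 1 / 2 * ⟪O (u - v), matCLM M (O (u - v))⟫ := by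
  have hv : y - O v = (y - O u) + O (u - v) := by rw [map_sub]; abel
  rw [potential, potential, hv, map_add, inner_add_left, inner_add_right, inner_add_right,
    inner_matCLM_comm hM (O (u - v)) (y - O u)]
  ring

/-- Bound for the quadratic form of a matrix pulled back along a bounded linear map. -/
theorem abs_inner_matCLM_apply_le {V : Type*} [NormedAddCommGroup V] [InnerProductSpace ℝ V]
    {s : ℕ} (O : V →L[ℝ] EuclideanSpace ℝ (Fin s)) (M : Matrix (Fin s) (Fin s) ℝ) (e : V) :
    |⟪O e, matCLM M (O e)⟫| ≤ ‖matCLM M‖ * ‖O‖ ^ 2 * ‖e‖ ^ 2 := by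
  calc |⟪O e, matCLM M (O e)⟫| ≤ ‖O e‖ * ‖matCLM M (O e)‖ := abs_real_inner_le_norm _ _
    _ ≤ ‖O e‖ * (‖matCLM M‖ * ‖O e‖) := by gcongr; exact (matCLM M).le_opNorm _
    _ = ‖matCLM M‖ * ‖O e‖ ^ 2 := by ring
    _ ≤ ‖matCLM M‖ * (‖O‖ * ‖e‖) ^ 2 := by gcongr; exact O.le_opNorm e
    _ = ‖matCLM M‖ * ‖O‖ ^ 2 * ‖e‖ ^ 2 := by ring

/-- **Error bound for the dual-weighted-residual corrected potential.**
Let `V_h ⊆ V` be a subspace, `u_h ∈ V_h` Galerkin state, `ψ_h ∈ V_h` Galerkin adjoint,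
and `u_r, ψ_r ∈ V_h` arbitrary. With `Δ = A(u_r, ψ_r) − F(ψ_r)`,
`|η(u_h) − η(u_r) − Δ| ≤ γ‖u_h − u_r‖‖ψ_h − ψ_r‖ + (1/2) C_O ‖u_h − u_r‖²`
where `C_O = ‖Γ⁻¹‖₂‖O‖²`. -/
theorem dwr_potential_error_bound
    {V : Type*} [NormedAddCommGroup V] [InnerProductSpace ℝ V] [CompleteSpace V]
    {s : ℕ}
    (A : V →L[ℝ] V →L[ℝ] ℝ) (F : V →L[ℝ] ℝ)
    (α γ : ℝ) (hα : 0 < α) (hγ : 0 < γ)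
    (hcoer : ∀ w : V, α * ‖w‖ ^ 2 ≤ A w w)
    (hcont : ∀ w v : V, A w v ≤ γ * ‖w‖ * ‖v‖)
    (O : V →L[ℝ] EuclideanSpace ℝ (Fin s)) (y : EuclideanSpace ℝ (Fin s))
    (Γinv : Matrix (Fin s) (Fin s) ℝ) (hΓsymm : Γinv.IsSymm) (hΓpd : Γinv.PosDef)
    (Vh : Submodule ℝ V) (uh ψh ur ψr : V)
    (huh : uh ∈ Vh) (hψh : ψh ∈ Vh) (hur : ur ∈ Vh) (hψr : ψr ∈ Vh)
    (hstate : ∀ v ∈ Vh, A uh v = F v)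
    (hadjoint : ∀ w ∈ Vh, A w ψh = ⟪y - O uh, matCLM Γinv (O w)⟫) :
    |potential O y Γinv uh - potential O y Γinv ur - (A ur ψr - F ψr)| ≤
      γ * ‖uh - ur‖ * ‖ψh - ψr‖ +
        (1 / 2) * (‖matCLM Γinv‖ * ‖O‖ ^ 2) * ‖uh - ur‖ ^ 2 := by
  have hdiff : potential O y Γinv uh - potential O y Γinv ur - (A ur ψr - F ψr) =
      -A (uh - ur) (ψh - ψr) - 1 / 2 * ⟪O (uh - ur), matCLM Γinv (O (uh - ur))⟫ := by
    rw [potential_sub_potential O y hΓsymm, ← hadjoint _ (Vh.sub_mem huh hur),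
      ← hstate ψr hψr]
    simp only [map_sub, sub_apply]
    ring
  have hA := hcont (uh - ur) (ψh - ψr)
  have hAneg := hcont (-(uh - ur)) (ψh - ψr)
  rw [map_neg, neg_apply, norm_neg] at hAneg
  have hq := abs_le.mp (abs_inner_matCLM_apply_le O Γinv (uh - ur))
  rw [hdiff, abs_le]
  constructor <;> linarith [hq.1, hq.2]
end

section
/- Let u_h : Θ → V and u_r : Θ → V be differentiable, define η_h(θ) = η(u_h(θ)) and η_r(θ) = η(u_r(θ)), and suppose ‖u_h(θ)‖_V ≤ C_u at a point θ ∈ Θ. Then ∑_{j=1}^d |∂_{θ_j}(η_h − η_r)(θ)| ≤ (C_y + C_O C_u) ∑_{j=1}^d ‖∂_{θ_j}(u_h − u_r)(θ)‖_V + C_O (∑_{j=1}^d ‖∂_{θ_j} u_r(θ)‖_V) ‖u_h(θ) − u_r(θ)‖_V. -/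
open scoped RealInnerProductSpace

theorem Matrix.IsHermitian.matCLM_inner_left {s : ℕ} {M : Matrix (Fin s) (Fin s) ℝ}
    (hM : M.IsHermitian) (v w : EuclideanSpace ℝ (Fin s)) :
    ⟪matCLM M v, w⟫ = ⟪v, matCLM M w⟫ :=
  Matrix.isSymmetric_toEuclideanLin_iff.mpr hM v w

section potential

variable {V E : Type*} [NormedAddCommGroup V] [InnerProductSpace ℝ V]
  [NormedAddCommGroup E] [NormedSpace ℝ E] {s : ℕ}

theorem hasFDerivAt_potential_comp (O : V →L[ℝ] EuclideanSpace ℝ (Fin s))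
    (y : EuclideanSpace ℝ (Fin s)) {M : Matrix (Fin s) (Fin s) ℝ} (hM : M.IsHermitian)
    {u : E → V} {u' : E →L[ℝ] V} {x : E} (hu : HasFDerivAt u u' x) :
    HasFDerivAt (fun t => potential O y M (u t))
      (-((innerSL ℝ (matCLM M (y - O (u x)))).comp (O.comp u'))) x := by
  have hres : HasFDerivAt (fun t => y - O (u t)) (-(O.comp u')) x :=
    (O.hasFDerivAt.comp x hu).const_sub y
  have hquad := (hres.inner ℝ ((matCLM M).hasFDerivAt.comp x hres)).const_mul (1 / 2)
  refine hquad.congr_fderiv ?_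
  ext v
  have hsymm := hM.matCLM_inner_left (y - O (u x)) (O (u' v))
  have hcomm := real_inner_comm (matCLM M (y - O (u x))) (O (u' v))
  simp only [smul_apply, ContinuousLinearMap.comp_apply,
    ContinuousLinearMap.prod_apply, fderivInnerCLM_apply, neg_apply,
    map_neg, inner_neg_right, inner_neg_left, innerSL_apply_apply, smul_eq_mul,
    Function.comp_apply]
  linarith

theorem abs_inner_matCLM_sub_le (O : V →L[ℝ] EuclideanSpace ℝ (Fin s))
    (y : EuclideanSpace ℝ (Fin s)) (M : Matrix (Fin s) (Fin s) ℝ) (a b a' b' : V) :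
    |⟪matCLM M (y - O a), O a'⟫ - ⟪matCLM M (y - O b), O b'⟫| ≤
      (‖matCLM M‖ * ‖O‖ * ‖y‖ + ‖matCLM M‖ * ‖O‖ ^ 2 * ‖a‖) * ‖a' - b'‖ +
        ‖matCLM M‖ * ‖O‖ ^ 2 * ‖b'‖ * ‖a - b‖ := by
  have hsplit : ⟪matCLM M (y - O a), O a'⟫ - ⟪matCLM M (y - O b), O b'⟫ =
      ⟪matCLM M (y - O a), O (a' - b')⟫ - ⟪matCLM M (O (a - b)), O b'⟫ := by
    simp only [map_sub, inner_sub_left, inner_sub_right]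
    ring
  have hbound (r : EuclideanSpace ℝ (Fin s)) (v : V) :
      |⟪matCLM M r, O v⟫| ≤ ‖matCLM M‖ * ‖r‖ * (‖O‖ * ‖v‖) :=
    (abs_real_inner_le_norm _ _).trans <| by
      gcongr
      exacts [(matCLM M).le_opNorm r, O.le_opNorm v]
  have hres : ‖y - O a‖ ≤ ‖y‖ + ‖O‖ * ‖a‖ :=
    (norm_sub_le _ _).trans (by gcongr; exact O.le_opNorm a)
  calc _ ≤ |⟪matCLM M (y - O a), O (a' - b')⟫| + |⟪matCLM M (O (a - b)), O b'⟫| := by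
        rw [hsplit]; exact abs_sub _ _
    _ ≤ ‖matCLM M‖ * (‖y‖ + ‖O‖ * ‖a‖) * (‖O‖ * ‖a' - b'‖) +
        ‖matCLM M‖ * (‖O‖ * ‖a - b‖) * (‖O‖ * ‖b'‖) := by
        gcongr
        · exact (hbound _ _).trans (by gcongr)
        · exact (hbound _ _).trans (by gcongr; exact O.le_opNorm _)
    _ = _ := by ring

end potential

/-- **Bound on the gradient of the potential error.**
With `η_h(θ) = η(u_h(θ))`, `η_r(θ) = η(u_r(θ))` for differentiable `u_h, u_r : Θ → V`,
and `‖u_h(θ)‖ ≤ C_u` at a point `θ ∈ Θ`,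
`∑_j |∂_{θ_j}(η_h − η_r)(θ)| ≤ (C_y + C_O C_u) ∑_j ‖∂_{θ_j}(u_h − u_r)(θ)‖ +
  C_O (∑_j ‖∂_{θ_j} u_r(θ)‖) ‖u_h(θ) − u_r(θ)‖`,
where `C_y = ‖Γ⁻¹‖₂‖O‖‖y‖₂` and `C_O = ‖Γ⁻¹‖₂‖O‖²`. -/
theorem potential_gradient_error_bound
    {V : Type*} [NormedAddCommGroup V] [InnerProductSpace ℝ V] [CompleteSpace V]
    {d s : ℕ} (Θ : Set (EuclideanSpace ℝ (Fin d))) (hΘ : IsOpen Θ)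
    (O : V →L[ℝ] EuclideanSpace ℝ (Fin s)) (y : EuclideanSpace ℝ (Fin s))
    (Γinv : Matrix (Fin s) (Fin s) ℝ) (hΓsymm : Γinv.IsSymm) (hΓpd : Γinv.PosDef)
    (uh ur : EuclideanSpace ℝ (Fin d) → V)
    (huh : ∀ θ ∈ Θ, DifferentiableAt ℝ uh θ)
    (hur : ∀ θ ∈ Θ, DifferentiableAt ℝ ur θ)
    (Cu : ℝ) (hCu : 0 ≤ Cu)
    (θ : EuclideanSpace ℝ (Fin d)) (hθ : θ ∈ Θ) (hbd : ‖uh θ‖ ≤ Cu) :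
    ∑ j : Fin d,
        |fderiv ℝ (fun t => potential O y Γinv (uh t) - potential O y Γinv (ur t)) θ
          (EuclideanSpace.single j (1 : ℝ))| ≤
      (‖matCLM Γinv‖ * ‖O‖ * ‖y‖ + ‖matCLM Γinv‖ * ‖O‖ ^ 2 * Cu) *
          ∑ j : Fin d, ‖fderiv ℝ (fun t => uh t - ur t) θ (EuclideanSpace.single j (1 : ℝ))‖ +
        ‖matCLM Γinv‖ * ‖O‖ ^ 2 *
          (∑ j : Fin d, ‖fderiv ℝ ur θ (EuclideanSpace.single j (1 : ℝ))‖) *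
          ‖uh θ - ur θ‖ := by
  have hh := (huh θ hθ).hasFDerivAt
  have hr := (hur θ hθ).hasFDerivAt
  have hM := hΓpd.isHermitian
  rw [((hasFDerivAt_potential_comp O y hM hh).fun_sub
    (hasFDerivAt_potential_comp O y hM hr)).fderiv, (hh.fun_sub hr).fderiv,
    Finset.mul_sum, Finset.mul_sum, Finset.sum_mul, ← Finset.sum_add_distrib]
  refine Finset.sum_le_sum fun j _ => ?_
  simp only [sub_apply, neg_apply,
    ContinuousLinearMap.comp_apply, innerSL_apply_apply]
  rw [neg_sub_neg, abs_sub_comm]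
  refine (abs_inner_matCLM_sub_le O y Γinv _ _ _ _).trans ?_
  gcongr
end

section
/- Let u_h, u_r, ψ_h, ψ_r : Θ → V be differentiable, set e_u(θ) = u_h(θ) − u_r(θ) and e_ψ(θ) = ψ_h(θ) − ψ_r(θ), and define g(θ) = −A(e_u(θ), e_ψ(θ); θ) − (1/2)(O(e_u(θ)))ᵀ Γ⁻¹ O(e_u(θ)) (which equals the error η_y^h(θ) − η_y^Δ(θ) between the high-fidelity potential and the dual-weighted-residual-corrected reduced potential). Then for every θ ∈ Θ, ∑_{j=1}^d |∂_{θ_j} g(θ)| ≤ γ(θ) (∑_{j=1}^d ‖∂_{θ_j} e_u(θ)‖_V) ‖e_ψ(θ)‖_V + γ(θ) (∑_{j=1}^d ‖∂_{θ_j} e_ψ(θ)‖_V) ‖e_u(θ)‖_V + (∑_{j=1}^d ρ_j(θ)) ‖e_u(θ)‖_V ‖e_ψ(θ)‖_V + C_O ‖e_u(θ)‖_V ∑_{j=1}^d ‖∂_{θ_j} e_u(θ)‖_V. -/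
open scoped RealInnerProductSpace

/-- A one-sided bound on a bilinear form is automatically a bound on its absolute value. -/
theorem abs_bilin_le_of_forall_le {V : Type*} [NormedAddCommGroup V] [NormedSpace ℝ V]
    {B : V →L[ℝ] V →L[ℝ] ℝ} {c : ℝ} (h : ∀ w v, B w v ≤ c * ‖w‖ * ‖v‖) (w v : V) :
    |B w v| ≤ c * ‖w‖ * ‖v‖ :=
  abs_le'.2 ⟨h w v, by simpa using h (-w) v⟩

/-- Cauchy–Schwarz for the form `(x, y) ↦ ⟪O x, M (O y)⟫`. -/
theorem abs_inner_comp_le {V W : Type*} [NormedAddCommGroup V] [NormedSpace ℝ V]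
    [NormedAddCommGroup W] [InnerProductSpace ℝ W] (O : V →L[ℝ] W) (M : W →L[ℝ] W) (x y : V) :
    |⟪O x, M (O y)⟫| ≤ ‖M‖ * ‖O‖ ^ 2 * ‖x‖ * ‖y‖ :=
  calc |⟪O x, M (O y)⟫| ≤ ‖O x‖ * ‖M (O y)‖ := abs_real_inner_le_norm _ _
    _ ≤ (‖O‖ * ‖x‖) * (‖M‖ * (‖O‖ * ‖y‖)) := by
        gcongr
        · exact O.le_opNorm x
        · exact (M.le_opNorm _).trans (by gcongr; exact O.le_opNorm y)
    _ = ‖M‖ * ‖O‖ ^ 2 * ‖x‖ * ‖y‖ := by ring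

/-- The derivative of `θ ↦ -A(e, p; θ) - ⟪O e, M O e⟫ / 2` in the direction `t`. -/
theorem fderiv_neg_bilin_sub_half_inner {E V W : Type*} [NormedAddCommGroup E] [NormedSpace ℝ E]
    [NormedAddCommGroup V] [NormedSpace ℝ V] [NormedAddCommGroup W] [InnerProductSpace ℝ W]
    {A : E → V →L[ℝ] V →L[ℝ] ℝ} {e p : E → V} {θ : E} (hA : DifferentiableAt ℝ A θ)
    (he : DifferentiableAt ℝ e θ) (hp : DifferentiableAt ℝ p θ)
    (O : V →L[ℝ] W) (M : W →L[ℝ] W) (t : E) :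
    fderiv ℝ (fun θ => -A θ (e θ) (p θ) - (1 / 2) * ⟪O (e θ), M (O (e θ))⟫) θ t =
      -(fderiv ℝ A θ t (e θ) (p θ) + A θ (fderiv ℝ e θ t) (p θ) + A θ (e θ) (fderiv ℝ p θ t)) -
        (1 / 2) * (⟪O (e θ), M (O (fderiv ℝ e θ t))⟫ + ⟪O (fderiv ℝ e θ t), M (O (e θ))⟫) := by
  have hO := O.hasFDerivAt.comp θ he.hasFDerivAt
  have hMO := M.hasFDerivAt.comp θ hO
  have hbil := (hA.hasFDerivAt.clm_apply he.hasFDerivAt).clm_apply hp.hasFDerivAt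
  have h := hbil.neg.sub ((hO.inner ℝ hMO).const_mul (1 / 2 : ℝ))
  refine (DFunLike.congr_fun h.fderiv t).trans ?_
  simp
  ring

/-- **Bound on the gradient of the dual-weighted-residual-corrected potential error.**
With `e_u = u_h − u_r`, `e_ψ = ψ_h − ψ_r` and
`g(θ) = −A(e_u(θ), e_ψ(θ); θ) − (1/2)(O e_u(θ))ᵀ Γ⁻¹ (O e_u(θ))`,
for every `θ ∈ Θ`,
`∑_j |∂_{θ_j} g(θ)| ≤ γ(θ)(∑_j ‖∂_{θ_j} e_u‖)‖e_ψ‖ + γ(θ)(∑_j ‖∂_{θ_j} e_ψ‖)‖e_u‖ +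
  (∑_j ρ_j(θ))‖e_u‖‖e_ψ‖ + C_O ‖e_u‖ ∑_j ‖∂_{θ_j} e_u‖`,
where `C_O = ‖Γ⁻¹‖₂‖O‖²`. -/
theorem dwr_gradient_error_bound
    {V : Type*} [NormedAddCommGroup V] [InnerProductSpace ℝ V] [CompleteSpace V]
    {d s : ℕ} (Θ : Set (EuclideanSpace ℝ (Fin d))) (hΘ : IsOpen Θ)
    (A : EuclideanSpace ℝ (Fin d) → V →L[ℝ] V →L[ℝ] ℝ)
    (γ : EuclideanSpace ℝ (Fin d) → ℝ)
    (ρ : Fin d → EuclideanSpace ℝ (Fin d) → ℝ)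
    (hA : ∀ θ ∈ Θ, DifferentiableAt ℝ A θ)
    (hcont : ∀ θ ∈ Θ, ∀ w v : V, A θ w v ≤ γ θ * ‖w‖ * ‖v‖)
    (hρ : ∀ θ ∈ Θ, ∀ j : Fin d, ∀ w v : V,
      fderiv ℝ A θ (EuclideanSpace.single j (1 : ℝ)) w v ≤ ρ j θ * ‖w‖ * ‖v‖)
    (O : V →L[ℝ] EuclideanSpace ℝ (Fin s))
    (Γinv : Matrix (Fin s) (Fin s) ℝ) (hΓsymm : Γinv.IsSymm) (hΓpd : Γinv.PosDef)
    (uh ur ψh ψr : EuclideanSpace ℝ (Fin d) → V)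
    (huh : ∀ θ ∈ Θ, DifferentiableAt ℝ uh θ)
    (hur : ∀ θ ∈ Θ, DifferentiableAt ℝ ur θ)
    (hψh : ∀ θ ∈ Θ, DifferentiableAt ℝ ψh θ)
    (hψr : ∀ θ ∈ Θ, DifferentiableAt ℝ ψr θ)
    (eu eψ : EuclideanSpace ℝ (Fin d) → V)
    (heu : eu = fun θ => uh θ - ur θ) (heψ : eψ = fun θ => ψh θ - ψr θ)
    (g : EuclideanSpace ℝ (Fin d) → ℝ)
    (hg : g = fun θ =>
      -A θ (eu θ) (eψ θ) - (1 / 2) * ⟪O (eu θ), matCLM Γinv (O (eu θ))⟫) :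
    ∀ θ ∈ Θ,
      ∑ j : Fin d, |fderiv ℝ g θ (EuclideanSpace.single j (1 : ℝ))| ≤
        γ θ * (∑ j : Fin d, ‖fderiv ℝ eu θ (EuclideanSpace.single j (1 : ℝ))‖) * ‖eψ θ‖ +
          γ θ * (∑ j : Fin d, ‖fderiv ℝ eψ θ (EuclideanSpace.single j (1 : ℝ))‖) * ‖eu θ‖ +
          (∑ j : Fin d, ρ j θ) * ‖eu θ‖ * ‖eψ θ‖ +
          ‖matCLM Γinv‖ * ‖O‖ ^ 2 * ‖eu θ‖ *
            ∑ j : Fin d, ‖fderiv ℝ eu θ (EuclideanSpace.single j (1 : ℝ))‖ := by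
  intro θ hθ
  have he : DifferentiableAt ℝ eu θ := heu ▸ (huh θ hθ).sub (hur θ hθ)
  have hp : DifferentiableAt ℝ eψ θ := heψ ▸ (hψh θ hθ).sub (hψr θ hθ)
  simp only [Finset.mul_sum, Finset.sum_mul, ← Finset.sum_add_distrib]
  refine Finset.sum_le_sum fun j _ => ?_
  rw [hg, fderiv_neg_bilin_sub_half_inner (hA θ hθ) he hp]
  set t : EuclideanSpace ℝ (Fin d) := EuclideanSpace.single j 1
  have h₁ := abs_le.1 (abs_bilin_le_of_forall_le (hρ θ hθ j) (eu θ) (eψ θ))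
  have h₂ := abs_le.1 (abs_bilin_le_of_forall_le (hcont θ hθ) (fderiv ℝ eu θ t) (eψ θ))
  have h₃ := abs_le.1 (abs_bilin_le_of_forall_le (hcont θ hθ) (eu θ) (fderiv ℝ eψ θ t))
  have h₄ := abs_le.1 (abs_inner_comp_le O (matCLM Γinv) (eu θ) (fderiv ℝ eu θ t))
  have h₅ := abs_le.1 (abs_inner_comp_le O (matCLM Γinv) (fderiv ℝ eu θ t) (eu θ))
  rw [mul_right_comm] at h₃ h₅
  rw [abs_le]
  constructor <;> linarith
end

section
/- Assume additionally that ∫ p_h |e| dλ < ∞ and ∫ p_h |exp(e) − 1| dλ < ∞, where e = η_h − η_r. Then the Kullback–Leibler divergence satisfies ∫ p_h(θ) log(p_h(θ)/p_r(θ)) dθ ≤ ∫ p_h(θ) |e(θ)| dθ + ∫ p_h(θ) |exp(e(θ)) − 1| dθ. -/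
open MeasureTheory

/-- **KL divergence bound between high-fidelity and reduced posteriors.**
With posterior densities `p_h = exp(−η_h) p_0 / Z_h` and `p_r = exp(−η_r) p_0 / Z_r`,
and `e = η_h − η_r`, if `∫ p_h |e| < ∞` and `∫ p_h |exp(e) − 1| < ∞`, then
`∫ p_h log(p_h/p_r) ≤ ∫ p_h |e| + ∫ p_h |exp(e) − 1|`. -/
theorem kl_divergence_bound {d : ℕ}
    (p0 ηh ηr : (Fin d → ℝ) → ℝ)
    (hp0meas : Measurable p0) (hp0nonneg : ∀ θ, 0 ≤ p0 θ)
    (hp0int : ∫ θ, p0 θ = 1)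
    (hηh : Measurable ηh) (hηr : Measurable ηr)
    (Zh Zr : ℝ)
    (hZh : Zh = ∫ θ, Real.exp (-ηh θ) * p0 θ)
    (hZr : Zr = ∫ θ, Real.exp (-ηr θ) * p0 θ)
    (hZhint : Integrable fun θ => Real.exp (-ηh θ) * p0 θ)
    (hZrint : Integrable fun θ => Real.exp (-ηr θ) * p0 θ)
    (hZhpos : 0 < Zh) (hZrpos : 0 < Zr)
    (ph pr : (Fin d → ℝ) → ℝ)
    (hph : ph = fun θ => Real.exp (-ηh θ) * p0 θ / Zh)
    (hpr : pr = fun θ => Real.exp (-ηr θ) * p0 θ / Zr)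
    (e : (Fin d → ℝ) → ℝ) (he : e = fun θ => ηh θ - ηr θ)
    (hint1 : Integrable fun θ => ph θ * |e θ|)
    (hint2 : Integrable fun θ => ph θ * |Real.exp (e θ) - 1|) :
    ∫ θ, ph θ * Real.log (ph θ / pr θ) ≤
      (∫ θ, ph θ * |e θ|) + ∫ θ, ph θ * |Real.exp (e θ) - 1| := by
  have hZh0 : Zh ≠ 0 := hZhpos.ne'
  have hZr0 : Zr ≠ 0 := hZrpos.ne'
  have hph_nonneg : ∀ θ, 0 ≤ ph θ := fun θ => by
    rw [hph]
    exact div_nonneg (mul_nonneg (Real.exp_pos _).le (hp0nonneg θ)) hZhpos.le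
  have hph_meas : Measurable ph := by
    rw [hph]
    fun_prop
  have he_meas : Measurable e := by
    rw [he]
    fun_prop
  have hph_int : Integrable ph := by
    rw [hph]
    exact hZhint.div_const Zh
  have hph_one : ∫ θ, ph θ = 1 := by
    rw [hph, integral_div, ← hZh, div_self hZh0]
  have hexp : ∀ θ, ph θ * Real.exp (e θ) = Real.exp (-ηr θ) * p0 θ / Zh := fun θ => by
    have h : Real.exp (-ηr θ) = Real.exp (-ηh θ) * Real.exp (ηh θ - ηr θ) := by
      rw [← Real.exp_add]
      ring_nf
    rw [hph, he, h]
    ring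
  have hlog : ∀ θ, ph θ * Real.log (ph θ / pr θ) =
      -(ph θ * e θ) + ph θ * Real.log (Zr / Zh) := fun θ => by
    rcases (hp0nonneg θ).eq_or_lt with h0 | h0
    · simp [hph, ← h0]
    · have hratio : ph θ / pr θ = Real.exp (-e θ) * (Zr / Zh) := by
        have h : Real.exp (-ηh θ) = Real.exp (-(ηh θ - ηr θ)) * Real.exp (-ηr θ) := by
          rw [← Real.exp_add]
          ring_nf
        simp only [hph, hpr, he]
        rw [h]
        field_simp
      rw [hratio, Real.log_mul (Real.exp_pos _).ne' (div_pos hZrpos hZhpos).ne', Real.log_exp]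
      ring
  have hphe_int : Integrable fun θ => ph θ * e θ :=
    hint1.mono' (hph_meas.mul he_meas).aestronglyMeasurable <| ae_of_all _ fun θ => by
      rw [Real.norm_eq_abs, abs_mul, abs_of_nonneg (hph_nonneg θ)]
  have hZ_ratio : Zr / Zh - 1 = ∫ θ, ph θ * (Real.exp (e θ) - 1) := by
    simp_rw [mul_sub, mul_one, hexp]
    rw [integral_sub (hZrint.div_const Zh) hph_int, integral_div, ← hZr, hph_one]
  have hlog_le : Real.log (Zr / Zh) ≤ ∫ θ, ph θ * |Real.exp (e θ) - 1| := by
    refine (Real.log_le_sub_one_of_pos (div_pos hZrpos hZhpos)).trans ?_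
    rw [hZ_ratio]
    refine (le_abs_self _).trans (abs_integral_le_integral_abs.trans_eq ?_)
    simp_rw [abs_mul, abs_of_nonneg (hph_nonneg _)]
  have hneg_le : ∫ θ, -(ph θ * e θ) ≤ ∫ θ, ph θ * |e θ| :=
    integral_mono hphe_int.neg hint1 fun θ => by
      have := mul_le_mul_of_nonneg_left (neg_le_abs (e θ)) (hph_nonneg θ)
      simpa using this
  simp_rw [hlog]
  rw [integral_add (by exact hphe_int.neg) (hph_int.mul_const _), integral_mul_const, hph_one, one_mul]
  exact add_le_add hneg_le hlog_le
end

section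
/- Assume additionally that |e(θ)| < 1 for all θ ∈ ℝ^d, where e = η_h − η_r, and that ∫ p_h |e| dλ < ∞. Then the Kullback–Leibler divergence satisfies ∫ p_h(θ) log(p_h(θ)/p_r(θ)) dθ ≤ 3 ∫ p_h(θ) |e(θ)| dθ. -/
open MeasureTheory

/-- **KL divergence bound under a uniformly small potential error.**
With posterior densities `p_h = exp(−η_h) p_0 / Z_h` and `p_r = exp(−η_r) p_0 / Z_r`,
and `e = η_h − η_r`, if `|e(θ)| < 1` for all `θ` and `∫ p_h |e| < ∞`, then
`∫ p_h log(p_h/p_r) ≤ 3 ∫ p_h |e|`. -/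
theorem kl_divergence_small_error_bound {d : ℕ}
    (p0 ηh ηr : (Fin d → ℝ) → ℝ)
    (hp0meas : Measurable p0) (hp0nonneg : ∀ θ, 0 ≤ p0 θ)
    (hp0int : ∫ θ, p0 θ = 1)
    (hηh : Measurable ηh) (hηr : Measurable ηr)
    (Zh Zr : ℝ)
    (hZh : Zh = ∫ θ, Real.exp (-ηh θ) * p0 θ)
    (hZr : Zr = ∫ θ, Real.exp (-ηr θ) * p0 θ)
    (hZhint : Integrable fun θ => Real.exp (-ηh θ) * p0 θ)
    (hZrint : Integrable fun θ => Real.exp (-ηr θ) * p0 θ)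
    (hZhpos : 0 < Zh) (hZrpos : 0 < Zr)
    (ph pr : (Fin d → ℝ) → ℝ)
    (hph : ph = fun θ => Real.exp (-ηh θ) * p0 θ / Zh)
    (hpr : pr = fun θ => Real.exp (-ηr θ) * p0 θ / Zr)
    (e : (Fin d → ℝ) → ℝ) (he : e = fun θ => ηh θ - ηr θ)
    (hint1 : Integrable fun θ => ph θ * |e θ|)
    (hsmall : ∀ θ, |e θ| < 1) :
    ∫ θ, ph θ * Real.log (ph θ / pr θ) ≤ 3 * ∫ θ, ph θ * |e θ| := by
  have hph_nonneg : ∀ θ, 0 ≤ ph θ := fun θ => by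
    rw [hph]
    exact div_nonneg (mul_nonneg (Real.exp_pos _).le (hp0nonneg θ)) hZhpos.le
  have hph_meas : Measurable ph := by rw [hph]; fun_prop
  have he_meas : Measurable e := by rw [he]; fun_prop
  have hph_int : Integrable ph := by rw [hph]; exact hZhint.div_const Zh
  have hph_one : ∫ θ, ph θ = 1 := by
    rw [hph, integral_div, ← hZh, div_self hZhpos.ne']
  have hphe_int : Integrable fun θ => ph θ * e θ :=
    hint1.mono' (hph_meas.mul he_meas).aestronglyMeasurable
      (.of_forall fun θ => by
        rw [Real.norm_eq_abs, abs_mul, abs_of_nonneg (hph_nonneg θ)])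
  have hratio_fun : (fun θ => Real.exp (-ηr θ) * p0 θ / Zh) = fun θ => ph θ * Real.exp (e θ) := by
    funext θ
    have hexp : Real.exp (-ηr θ) = Real.exp (-ηh θ) * Real.exp (e θ) := by
      rw [← Real.exp_add, he]
      ring_nf
    simp only [hph, hexp]
    ring
  have hratio_int : Integrable fun θ => ph θ * Real.exp (e θ) := by
    rw [← hratio_fun]
    exact hZrint.div_const Zh
  have hratio : Zr / Zh = ∫ θ, ph θ * Real.exp (e θ) := by
    rw [← hratio_fun, integral_div, ← hZr]
  have hlog : Real.log (Zr / Zh) ≤ 2 * ∫ θ, ph θ * |e θ| := by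
    calc
      Real.log (Zr / Zh) ≤ Zr / Zh - 1 := Real.log_le_sub_one_of_pos (div_pos hZrpos hZhpos)
      _ = ∫ θ, (ph θ * Real.exp (e θ) - ph θ) := by
        rw [integral_sub hratio_int hph_int, hratio, hph_one]
      _ ≤ ∫ θ, 2 * (ph θ * |e θ|) := by
        refine integral_mono (hratio_int.sub hph_int) (hint1.const_mul 2) fun θ => ?_
        have hexp := (le_abs_self _).trans (Real.abs_exp_sub_one_le (hsmall θ).le)
        have := mul_le_mul_of_nonneg_left hexp (hph_nonneg θ)
        dsimp only
        linarith
      _ = 2 * ∫ θ, ph θ * |e θ| := integral_const_mul _ _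
  have hintegrand : ∀ θ, ph θ * Real.log (ph θ / pr θ)
      = Real.log (Zr / Zh) * ph θ - ph θ * e θ := fun θ => by
    rcases (hp0nonneg θ).eq_or_lt with h0 | h0
    · simp [hph, ← h0]
    · have hquot : ph θ / pr θ = Zr / Zh * Real.exp (-e θ) := by
        have hexp : Real.exp (-ηh θ) = Real.exp (-ηr θ) * Real.exp (-e θ) := by
          rw [← Real.exp_add, he]
          ring_nf
        simp only [hph, hpr, hexp]
        field_simp
      rw [hquot, Real.log_mul (div_pos hZrpos hZhpos).ne' (Real.exp_pos _).ne', Real.log_exp]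
      ring
  have hneg : -∫ θ, ph θ * e θ ≤ ∫ θ, ph θ * |e θ| := by
    rw [← integral_neg]
    refine integral_mono hphe_int.neg hint1 fun θ => ?_
    have := mul_le_mul_of_nonneg_left (neg_le_abs (e θ)) (hph_nonneg θ)
    dsimp only
    linarith
  simp_rw [hintegrand]
  rw [integral_sub (hph_int.const_mul _) hphe_int, integral_const_mul, hph_one]
  linarith
end

section
/- Assume additionally there is a measurable function b : ℝ^d → [0,∞) such that |η_h(θ) − η_r(θ)| ≤ b(θ) for all θ ∈ ℝ^d, and that ∫ p_h b dλ < ∞ and ∫ p_h (exp(b) − 1) dλ < ∞. Then ∫ p_h(θ) log(p_h(θ)/p_r(θ)) dθ ≤ ∫ p_h(θ) b(θ) dθ + ∫ p_h(θ) (exp(b(θ)) − 1) dθ. -/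
open MeasureTheory

/-- **KL divergence bound via a pointwise error bound on the potential.**
With posterior densities `p_h = exp(−η_h) p_0 / Z_h` and `p_r = exp(−η_r) p_0 / Z_r`,
if `|η_h(θ) − η_r(θ)| ≤ b(θ)` for a measurable `b ≥ 0` with `∫ p_h b < ∞` and
`∫ p_h (exp(b) − 1) < ∞`, then
`∫ p_h log(p_h/p_r) ≤ ∫ p_h b + ∫ p_h (exp(b) − 1)`. -/
theorem kl_divergence_bound_via_error_bound {d : ℕ}
    (p0 ηh ηr : (Fin d → ℝ) → ℝ)
    (hp0meas : Measurable p0) (hp0nonneg : ∀ θ, 0 ≤ p0 θ)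
    (hp0int : ∫ θ, p0 θ = 1)
    (hηh : Measurable ηh) (hηr : Measurable ηr)
    (Zh Zr : ℝ)
    (hZh : Zh = ∫ θ, Real.exp (-ηh θ) * p0 θ)
    (hZr : Zr = ∫ θ, Real.exp (-ηr θ) * p0 θ)
    (hZhint : Integrable fun θ => Real.exp (-ηh θ) * p0 θ)
    (hZrint : Integrable fun θ => Real.exp (-ηr θ) * p0 θ)
    (hZhpos : 0 < Zh) (hZrpos : 0 < Zr)
    (ph pr : (Fin d → ℝ) → ℝ)
    (hph : ph = fun θ => Real.exp (-ηh θ) * p0 θ / Zh)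
    (hpr : pr = fun θ => Real.exp (-ηr θ) * p0 θ / Zr)
    (b : (Fin d → ℝ) → ℝ) (hbmeas : Measurable b) (hbnonneg : ∀ θ, 0 ≤ b θ)
    (hb : ∀ θ, |ηh θ - ηr θ| ≤ b θ)
    (hint1 : Integrable fun θ => ph θ * b θ)
    (hint2 : Integrable fun θ => ph θ * (Real.exp (b θ) - 1)) :
    ∫ θ, ph θ * Real.log (ph θ / pr θ) ≤
      (∫ θ, ph θ * b θ) + ∫ θ, ph θ * (Real.exp (b θ) - 1) := by
  have hphint : Integrable ph := hph ▸ hZhint.div_const Zh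
  have hprint : Integrable pr := hpr ▸ hZrint.div_const Zr
  have hph_one : ∫ θ, ph θ = 1 := by
    rw [hph, integral_div, ← hZh, div_self hZhpos.ne']
  have hpr_one : ∫ θ, pr θ = 1 := by
    rw [hpr, integral_div, ← hZr, div_self hZrpos.ne']
  have hph_nonneg (θ) : 0 ≤ ph θ := by
    rw [hph]
    exact div_nonneg (mul_nonneg (Real.exp_pos _).le (hp0nonneg θ)) hZhpos.le
  have hlog (θ) : ph θ * Real.log (ph θ / pr θ) =
      ph θ * (ηr θ - ηh θ) + ph θ * Real.log (Zr / Zh) := by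
    rcases (hp0nonneg θ).eq_or_lt with h0 | h0
    · simp [hph, ← h0]
    · have hquot : ph θ / pr θ = Real.exp (ηr θ - ηh θ) * (Zr / Zh) := by
        have hexp : Real.exp (-ηh θ) = Real.exp (ηr θ - ηh θ) * Real.exp (-ηr θ) := by
          rw [← Real.exp_add]
          ring_nf
        simp only [hph, hpr, hexp]
        field_simp
      rw [hquot, Real.log_mul (Real.exp_pos _).ne' (div_pos hZrpos hZhpos).ne', Real.log_exp,
        mul_add]
  have hdiffint : Integrable fun θ => ph θ * (ηr θ - ηh θ) := by
    refine hint1.mono (hphint.aestronglyMeasurable.mul (hηr.sub hηh).aestronglyMeasurable)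
      (.of_forall fun θ => ?_)
    rw [norm_mul, norm_mul, Real.norm_eq_abs (_ - _), abs_sub_comm, Real.norm_of_nonneg (hbnonneg θ)]
    gcongr
    exact hb θ
  have hratio : Zr / Zh - 1 ≤ ∫ θ, ph θ * (Real.exp (b θ) - 1) := by
    have hprod : ∫ θ, Zr / Zh * pr θ - ph θ = Zr / Zh - 1 := by
      rw [integral_sub (hprint.const_mul _) hphint, integral_const_mul, hph_one, hpr_one, mul_one]
    rw [← hprod]
    refine integral_mono ((hprint.const_mul _).sub hphint) hint2 fun θ => ?_
    have hpr_eq : Zr / Zh * pr θ = ph θ * Real.exp (ηh θ - ηr θ) := by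
      have hexp : Real.exp (-ηr θ) = Real.exp (ηh θ - ηr θ) * Real.exp (-ηh θ) := by
        rw [← Real.exp_add]
        ring_nf
      simp only [hph, hpr, hexp]
      field_simp
    have hle : Real.exp (ηh θ - ηr θ) ≤ Real.exp (b θ) :=
      Real.exp_le_exp.2 ((le_abs_self _).trans (hb θ))
    simp only [hpr_eq, mul_sub, mul_one]
    exact sub_le_sub_right (mul_le_mul_of_nonneg_left hle (hph_nonneg θ)) _
  have hdiff : ∫ θ, ph θ * (ηr θ - ηh θ) ≤ ∫ θ, ph θ * b θ := by
    refine integral_mono hdiffint hint1 fun θ => mul_le_mul_of_nonneg_left ?_ (hph_nonneg θ)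
    exact (neg_sub (ηh θ) (ηr θ) ▸ neg_le_abs (ηh θ - ηr θ)).trans (hb θ)
  simp only [hlog]
  rw [integral_add hdiffint (hphint.mul_const _), integral_mul_const, hph_one, one_mul]
  exact add_le_add hdiff
    ((Real.log_le_sub_one_of_pos (div_pos hZrpos hZhpos)).trans hratio)
end

section
/- Let V_h be a subspace of V. Suppose u_h ∈ V_h satisfies A(u_h, v) = F(v) for all v ∈ V_h and ψ_h ∈ V_h satisfies A(w, ψ_h) = (y − O(u_h))ᵀ Γ⁻¹ O(w) for all w ∈ V_h; let u_r, ψ_r ∈ V_h be arbitrary. Define the adjoint residual dual norm ‖R_ψ‖ = sup { |A(w, ψ_r) − (y − O(u_r))ᵀ Γ⁻¹ O(w)| : w ∈ V_h, ‖w‖_V ≤ 1 }. Then ‖ψ_h − ψ_r‖_V ≤ ‖R_ψ‖ / α + (C_O/α) ‖u_h − u_r‖_V. -/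
open scoped RealInnerProductSpace

/-- A bounded functional is controlled on a subspace by its dual norm over that subspace. -/
theorem abs_apply_le_sSup_mul_norm {V : Type*} [NormedAddCommGroup V] [NormedSpace ℝ V]
    (f : V →L[ℝ] ℝ) (W : Submodule ℝ V) {w : V} (hw : w ∈ W) :
    |f w| ≤ sSup {r : ℝ | ∃ v ∈ W, ‖v‖ ≤ 1 ∧ r = |f v|} * ‖w‖ := by
  rcases eq_or_ne w 0 with rfl | hw0
  · simp
  have hpos : 0 < ‖w‖ := norm_pos_iff.mpr hw0
  have hbdd : BddAbove {r : ℝ | ∃ v ∈ W, ‖v‖ ≤ 1 ∧ r = |f v|} := by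
    refine ⟨‖f‖, ?_⟩
    rintro r ⟨v, -, hv, rfl⟩
    exact f.unit_le_opNorm v hv
  have hle := le_csSup hbdd ⟨‖w‖⁻¹ • w, W.smul_mem _ hw,
    by rw [norm_smul, norm_inv, norm_norm, inv_mul_cancel₀ hpos.ne'], rfl⟩
  rwa [map_smul, smul_eq_mul, abs_mul, abs_inv, abs_norm, inv_mul_le_iff₀ hpos,
    mul_comm ‖w‖] at hle

/-- **A-posteriori error bound for the reduced adjoint.**
Let `V_h ⊆ V` be a subspace, `u_h ∈ V_h` the Galerkin state, `ψ_h ∈ V_h` the Galerkin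
adjoint (`A(w, ψ_h) = (y − O(u_h))ᵀ Γ⁻¹ O(w)` for all `w ∈ V_h`), and
`u_r, ψ_r ∈ V_h` arbitrary. With the adjoint residual dual norm
`‖R_ψ‖ = sup { |A(w, ψ_r) − (y − O(u_r))ᵀ Γ⁻¹ O(w)| : w ∈ V_h, ‖w‖ ≤ 1 }`, one has
`‖ψ_h − ψ_r‖ ≤ ‖R_ψ‖/α + (C_O/α)‖u_h − u_r‖` where `C_O = ‖Γ⁻¹‖₂‖O‖²`. -/
theorem adjoint_residual_bound
    {V : Type*} [NormedAddCommGroup V] [InnerProductSpace ℝ V] [CompleteSpace V]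
    {s : ℕ}
    (A : V →L[ℝ] V →L[ℝ] ℝ) (F : V →L[ℝ] ℝ)
    (α : ℝ) (hα : 0 < α)
    (hcoer : ∀ w : V, α * ‖w‖ ^ 2 ≤ A w w)
    (O : V →L[ℝ] EuclideanSpace ℝ (Fin s)) (y : EuclideanSpace ℝ (Fin s))
    (Γinv : Matrix (Fin s) (Fin s) ℝ) (hΓsymm : Γinv.IsSymm) (hΓpd : Γinv.PosDef)
    (Vh : Submodule ℝ V) (uh ψh ur ψr : V)
    (huh : uh ∈ Vh) (hψh : ψh ∈ Vh) (hur : ur ∈ Vh) (hψr : ψr ∈ Vh)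
    (hstate : ∀ v ∈ Vh, A uh v = F v)
    (hadjoint : ∀ w ∈ Vh, A w ψh = ⟪y - O uh, matCLM Γinv (O w)⟫)
    (Rnorm : ℝ)
    (hR : Rnorm = sSup {r : ℝ | ∃ w ∈ Vh, ‖w‖ ≤ 1 ∧
      r = |A w ψr - ⟪y - O ur, matCLM Γinv (O w)⟫|}) :
    ‖ψh - ψr‖ ≤ Rnorm / α + ‖matCLM Γinv‖ * ‖O‖ ^ 2 / α * ‖uh - ur‖ := by
  have hmem : ψh - ψr ∈ Vh := Vh.sub_mem hψh hψr
  have hres : |A (ψh - ψr) ψr - ⟪y - O ur, matCLM Γinv (O (ψh - ψr))⟫|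
      ≤ Rnorm * ‖ψh - ψr‖ := by
    rw [hR]
    exact abs_apply_le_sSup_mul_norm
      (A.flip ψr - (innerSL ℝ (y - O ur)).comp ((matCLM Γinv).comp O)) Vh hmem
  have hobs : ⟪O (ur - uh), matCLM Γinv (O (ψh - ψr))⟫
      ≤ ‖matCLM Γinv‖ * ‖O‖ ^ 2 * ‖uh - ur‖ * ‖ψh - ψr‖ :=
    calc ⟪O (ur - uh), matCLM Γinv (O (ψh - ψr))⟫
        ≤ ‖O (ur - uh)‖ * ‖matCLM Γinv (O (ψh - ψr))‖ := real_inner_le_norm _ _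
      _ ≤ (‖O‖ * ‖ur - uh‖) * (‖matCLM Γinv‖ * (‖O‖ * ‖ψh - ψr‖)) := by
          gcongr
          · exact O.le_opNorm _
          · exact (matCLM Γinv).le_opNorm_of_le (O.le_opNorm _)
      _ = ‖matCLM Γinv‖ * ‖O‖ ^ 2 * ‖uh - ur‖ * ‖ψh - ψr‖ := by
          rw [norm_sub_rev ur uh]; ring
  have hsplit : A (ψh - ψr) (ψh - ψr) = ⟪O (ur - uh), matCLM Γinv (O (ψh - ψr))⟫
      - (A (ψh - ψr) ψr - ⟪y - O ur, matCLM Γinv (O (ψh - ψr))⟫) := by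
    rw [map_sub (A (ψh - ψr)), hadjoint _ hmem,
      show y - O uh = O (ur - uh) + (y - O ur) by rw [map_sub]; abel, inner_add_left]
    ring
  have hsq : α * ‖ψh - ψr‖ * ‖ψh - ψr‖
      ≤ (Rnorm + ‖matCLM Γinv‖ * ‖O‖ ^ 2 * ‖uh - ur‖) * ‖ψh - ψr‖ := by
    linarith [hcoer (ψh - ψr), neg_abs_le
      (A (ψh - ψr) ψr - ⟪y - O ur, matCLM Γinv (O (ψh - ψr))⟫)]
  have hRnonneg : 0 ≤ Rnorm := by
    rw [hR]
    refine Real.sSup_nonneg ?_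
    rintro r ⟨w, -, -, rfl⟩
    exact abs_nonneg _
  rw [div_mul_eq_mul_div, ← add_div, le_div_iff₀' hα]
  rcases (norm_nonneg (ψh - ψr)).eq_or_lt with h0 | hpos
  · rw [← h0, mul_zero]
    positivity
  · exact le_of_mul_le_mul_right hsq hpos
end
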